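/- Let Θ ⊂ ℝ be countable and (a_θ)_{θ∈Θ} ⊂ ℂ satisfy Σ_{θ∈Θ, θ≠0} |a_θ|(1 + |θ|^{−1}) < ∞, and let f(x) = Σ_{θ∈Θ} a_θ e^{iθx} be the corresponding continuous almost-periodic function. Let I, J, K ⊂ ℝ be intervals with dist(I,J) ≥ c > 0 and dist(J,K) ≥ c > 0, and let S_{I,J,K}(f) be the operator on L²(ℝ) with kernel S_{I,J,K}(x,y; f) = χ_I(x) χ_K(y) ∫_J f(z)/((z−x)(z−y)) dz. Then ‖S_{I,J,K}(f) − S_{I,J,K}(ℳ(f))‖₁ ≤ C, with C independent of the intervals I, J, K. -/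

import Mathlib

open MeasureTheory Filter Set Complex Real
open scoped ENNReal Topology

noncomputable section

/-- The Hilbert space `L²(ℝ)`. -/
abbrev L2R : Type := MeasureTheory.Lp ℂ 2 (MeasureTheory.volume : MeasureTheory.Measure ℝ)

/-- The `n`-th approximation number (= singular value) of a bounded operator on a Hilbert
space. -/
noncomputable def sNum {E : Type*} [NormedAddCommGroup E] [InnerProductSpace ℂ E]
    (A : E →L[ℂ] E) (n : ℕ) : ℝ :=
  sInf {r : ℝ | ∃ F : E →L[ℂ] E,
    Module.rank ℂ ↥(LinearMap.range (F : E →ₗ[ℂ] E)) ≤ (n : Cardinal) ∧ r = ‖A - F‖}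

/-- The trace norm (Schatten `𝔖₁`-norm) of an operator, with value in `ℝ≥0∞`. -/
noncomputable def traceNorm {E : Type*} [NormedAddCommGroup E] [InnerProductSpace ℂ E]
    (A : E →L[ℂ] E) : ℝ≥0∞ :=
  ∑' n : ℕ, ENNReal.ofReal (sNum A n)

/-- An operator `A` on `L²(ℝ)` has integral kernel `K`. -/
def HasKernel (A : L2R →L[ℂ] L2R) (K : ℝ → ℝ → ℂ) : Prop :=
  ∀ f : L2R, (A f : ℝ → ℂ) =ᵐ[MeasureTheory.volume] fun x => ∫ y, K x y * (f : ℝ → ℂ) y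

/-- The distance between two subsets of `ℝ`. -/
noncomputable def sDist (A B : Set ℝ) : ℝ :=
  sInf {d : ℝ | ∃ x ∈ A, ∃ y ∈ B, d = |x - y|}

section ApproximationNumbers

variable {E : Type*} [NormedAddCommGroup E] [InnerProductSpace ℂ E]

lemma sNum_le_norm_sub (A F : E →L[ℂ] E) (n : ℕ)
    (hF : Module.rank ℂ ↥(LinearMap.range (F : E →ₗ[ℂ] E)) ≤ (n : Cardinal)) :
    sNum A n ≤ ‖A - F‖ :=
  csInf_le ⟨0, by rintro r ⟨F, -, rfl⟩; exact norm_nonneg _⟩ ⟨F, hF, rfl⟩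

lemma sNum_nonneg (A : E →L[ℂ] E) (n : ℕ) : 0 ≤ sNum A n :=
  Real.sInf_nonneg (by rintro r ⟨F, -, rfl⟩; exact norm_nonneg _)

lemma sNum_antitone (A : E →L[ℂ] E) : Antitone (sNum A) := by
  intro m n hmn
  refine le_csInf ⟨‖A - 0‖, 0, ?_, rfl⟩ ?_
  · change LinearMap.rank (0 : E →ₗ[ℂ] E) ≤ _
    simp
  · rintro r ⟨F, hF, rfl⟩
    exact sNum_le_norm_sub A F n (hF.trans (by exact_mod_cast hmn))

instance hasOrthogonalProjection_span_range {n : ℕ} (e : Fin n → E) :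
    (Submodule.span ℂ (Set.range e)).HasOrthogonalProjection :=
  haveI := FiniteDimensional.span_of_finite ℂ (Set.finite_range e)
  inferInstance

lemma rank_starProjection_span_le {n : ℕ} (e : Fin n → E) :
    LinearMap.rank ((Submodule.span ℂ (Set.range e)).starProjection : E →ₗ[ℂ] E) ≤
      (n : Cardinal) := by
  have h : LinearMap.range ((Submodule.span ℂ (Set.range e)).starProjection : E →ₗ[ℂ] E)
      = Submodule.span ℂ (Set.range e) := Submodule.range_starProjection _
  rw [LinearMap.rank, h]
  refine (rank_span_le _).trans ?_
  simpa using Cardinal.mk_range_le_lift (f := e)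

/-- Compressing an operator to the complements of two spans of `n` vectors changes it by an
operator of rank at most `2n`. -/
lemma sNum_two_mul_le {n : ℕ} (A : E →L[ℂ] E) (e f : Fin n → E) :
    sNum A (2 * n) ≤ ‖(1 - (Submodule.span ℂ (Set.range f)).starProjection) *
      (A * (1 - (Submodule.span ℂ (Set.range e)).starProjection))‖ := by
  set P := (Submodule.span ℂ (Set.range e)).starProjection with hP
  set Q := (Submodule.span ℂ (Set.range f)).starProjection with hQ
  have key : (1 - Q) * (A * (1 - P)) = A - (((1 - Q) * A) * P + Q * A) := by noncomm_ring
  rw [key]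
  apply sNum_le_norm_sub
  change LinearMap.rank ((((1 - Q) * A : E →L[ℂ] E) : E →ₗ[ℂ] E) ∘ₗ (P : E →ₗ[ℂ] E) +
    (Q : E →ₗ[ℂ] E) ∘ₗ (A : E →ₗ[ℂ] E)) ≤ _
  refine (LinearMap.rank_add_le _ _).trans ?_
  have h1 := (LinearMap.rank_comp_le_right (P : E →ₗ[ℂ] E)
    (((1 - Q) * A : E →L[ℂ] E) : E →ₗ[ℂ] E)).trans (rank_starProjection_span_le e)
  have h2 := (LinearMap.rank_comp_le_left (A : E →ₗ[ℂ] E)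
    (Q : E →ₗ[ℂ] E)).trans (rank_starProjection_span_le f)
  refine (add_le_add h1 h2).trans (le_of_eq ?_)
  push_cast
  ring

lemma exists_orthonormal_mul_sum_sNum_le (A : E →L[ℂ] E) {r : ℝ} (hr0 : 0 ≤ r) (hr : r < 1)
    (n : ℕ) (hpos : ∀ k < n, 0 < sNum A (2 * k)) :
    ∃ e f : Fin n → E, Orthonormal ℂ e ∧ Orthonormal ℂ f ∧
      r * ∑ k ∈ Finset.range n, sNum A (2 * k) ≤ ∑ k, ‖inner ℂ (f k) (A (e k))‖ := by
  induction n with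
  | zero =>
    exact ⟨Fin.elim0, Fin.elim0, by simp [Orthonormal, Pairwise],
      by simp [Orthonormal, Pairwise], by simp⟩
  | succ n ih =>
    obtain ⟨e, f, he, hf, hs⟩ := ih fun k hk => hpos k (hk.trans (Nat.lt_succ_self n))
    set U := Submodule.span ℂ (Set.range e) with hU
    set V := Submodule.span ℂ (Set.range f) with hV
    have hB := sNum_two_mul_le A e f
    have hsn := hpos n (Nat.lt_succ_self n)
    obtain ⟨x, hx⟩ : ∃ x, r * sNum A (2 * n) * ‖x‖ <
        ‖((1 - V.starProjection) * (A * (1 - U.starProjection))) x‖ := by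
      by_contra! h
      have := ContinuousLinearMap.opNorm_le_bound _ (by positivity) h
      nlinarith
    set y := x - U.starProjection x with hy
    set w := A y - V.starProjection (A y) with hw
    have hBx : ((1 - V.starProjection) * (A * (1 - U.starProjection))) x = w := rfl
    rw [hBx] at hx
    have hyU : y ∈ Uᗮ := U.sub_starProjection_mem_orthogonal x
    have hwV : w ∈ Vᗮ := V.sub_starProjection_mem_orthogonal (A y)
    have hyx : ‖y‖ ≤ ‖x‖ := by
      have h1 := Submodule.norm_starProjection_apply_le Uᗮ x
      rwa [Submodule.starProjection_orthogonal_val] at h1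
    have hw0 : 0 < ‖w‖ := lt_of_le_of_lt (by positivity) hx
    have hy0 : 0 < ‖y‖ := by
      rw [norm_pos_iff]
      intro h
      rw [hw, h] at hw0
      simp at hw0
    have hinner : inner ℂ w (A y) = (‖w‖ : ℂ) ^ 2 := by
      have h1 : A y = w + V.starProjection (A y) := by rw [hw]; abel
      have h2 : inner ℂ w (V.starProjection (A y)) = 0 :=
        Submodule.inner_left_of_mem_orthogonal (V.starProjection_apply_mem _) hwV
      conv_lhs => rw [h1]
      rw [inner_add_right, h2, add_zero, inner_self_eq_norm_sq_to_K]
      rfl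
    refine ⟨Matrix.vecCons ((‖y‖ : ℂ)⁻¹ • y) e, Matrix.vecCons ((‖w‖ : ℂ)⁻¹ • w) f, ?_, ?_, ?_⟩
    · rw [orthonormal_vecCons_iff]
      refine ⟨by simp [norm_smul, hy0.ne'], fun i => ?_, he⟩
      rw [inner_smul_left, Submodule.inner_left_of_mem_orthogonal
        (Submodule.subset_span (Set.mem_range_self i)) hyU, mul_zero]
    · rw [orthonormal_vecCons_iff]
      refine ⟨by simp [norm_smul, hw0.ne'], fun i => ?_, hf⟩
      rw [inner_smul_left, Submodule.inner_left_of_mem_orthogonal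
        (Submodule.subset_span (Set.mem_range_self i)) hwV, mul_zero]
    · rw [Fin.sum_univ_succ, Finset.sum_range_succ]
      simp only [Matrix.cons_val_zero, Matrix.cons_val_succ, map_smul]
      have h3 : ‖inner ℂ ((‖w‖ : ℂ)⁻¹ • w) ((‖y‖ : ℂ)⁻¹ • A y)‖ = ‖w‖ / ‖y‖ := by
        rw [inner_smul_left, inner_smul_right, hinner]
        simp
        field_simp
      have h4 : r * sNum A (2 * n) ≤ ‖w‖ / ‖y‖ := by
        rw [le_div_iff₀ hy0]
        exact (mul_le_mul_of_nonneg_left hyx (by positivity)).trans hx.le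
      rw [h3, mul_add]
      linarith

lemma sum_sNum_two_mul_le (A : E →L[ℂ] E) (H : ℝ)
    (hH : ∀ (n : ℕ) (e f : Fin n → E), Orthonormal ℂ e → Orthonormal ℂ f →
      ∑ k, ‖inner ℂ (f k) (A (e k))‖ ≤ H) (n : ℕ) :
    ∑ k ∈ Finset.range n, sNum A (2 * k) ≤ H := by
  have main : ∀ n, (∀ k < n, 0 < sNum A (2 * k)) →
      ∑ k ∈ Finset.range n, sNum A (2 * k) ≤ H := by
    intro n hpos
    have h1 : ∀ r ∈ Set.Ioo (0 : ℝ) 1, r * ∑ k ∈ Finset.range n, sNum A (2 * k) ≤ H := by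
      intro r hr
      obtain ⟨e, f, he, hf, hs⟩ := exists_orthonormal_mul_sum_sNum_le A hr.1.le hr.2 n hpos
      exact hs.trans (hH n e f he hf)
    have h2 : Tendsto (fun r : ℝ => r * ∑ k ∈ Finset.range n, sNum A (2 * k)) (𝓝[<] 1)
        (𝓝 (1 * ∑ k ∈ Finset.range n, sNum A (2 * k))) :=
      (tendsto_id.mono_left nhdsWithin_le_nhds).mul_const _
    rw [one_mul] at h2
    refine le_of_tendsto h2 ?_
    filter_upwards [Ioo_mem_nhdsLT (show (0 : ℝ) < 1 by norm_num)] with r hr using h1 r hr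
  induction n with
  | zero => exact main 0 (by simp)
  | succ n ih =>
    by_cases hpos : ∀ k < n + 1, 0 < sNum A (2 * k)
    · exact main (n + 1) hpos
    · push Not at hpos
      obtain ⟨k, hk, hk0⟩ := hpos
      have hn0 : sNum A (2 * n) = 0 :=
        le_antisymm ((sNum_antitone A (by omega)).trans hk0) (sNum_nonneg A _)
      rw [Finset.sum_range_succ, hn0, add_zero]
      exact ih

/-- An operator all of whose diagonal sums over pairs of orthonormal families are bounded is of
trace class. -/
lemma traceNorm_le_of_sum_inner_le (A : E →L[ℂ] E) (H : ℝ)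
    (hH : ∀ (n : ℕ) (e f : Fin n → E), Orthonormal ℂ e → Orthonormal ℂ f →
      ∑ k, ‖inner ℂ (f k) (A (e k))‖ ≤ H) :
    traceNorm A ≤ ENNReal.ofReal (2 * H) := by
  refine ENNReal.tsum_le_of_sum_range_le fun n => ?_
  rw [← ENNReal.ofReal_sum_of_nonneg fun k _ => sNum_nonneg A k]
  apply ENNReal.ofReal_le_ofReal
  have h1 : ∀ m, ∑ k ∈ Finset.range (2 * m), sNum A k ≤
      2 * ∑ k ∈ Finset.range m, sNum A (2 * k) := by
    intro m
    induction m with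
    | zero => simp
    | succ m ih =>
      rw [show 2 * (m + 1) = 2 * m + 1 + 1 by ring, Finset.sum_range_succ, Finset.sum_range_succ,
        Finset.sum_range_succ]
      have := sNum_antitone A (Nat.le_succ (2 * m))
      simp only [Nat.succ_eq_add_one] at this
      linarith
  calc ∑ k ∈ Finset.range n, sNum A k ≤ ∑ k ∈ Finset.range (2 * n), sNum A k :=
        Finset.sum_le_sum_of_subset_of_nonneg (Finset.range_mono (by omega))
          fun k _ _ => sNum_nonneg A k
    _ ≤ _ := h1 n
    _ ≤ 2 * H := by
        have := sum_sNum_two_mul_le A H hH n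
        linarith

end ApproximationNumbers

section NuclearKernels

/-- A kernel that is absolutely integrable against any pair of `L²` functions, and whose diagonal
sums over pairs of orthonormal families are bounded by `H`. -/
structure NuclearKernel (k : ℝ → ℝ → ℂ) (H : ℝ) : Prop where
  integrable : ∀ f e : L2R, Integrable
    (fun q : ℝ × ℝ => starRingEnd ℂ (f q.1) * k q.1 q.2 * e q.2) (volume.prod volume)
  sum_le : ∀ (n : ℕ) (f e : Fin n → L2R), Orthonormal ℂ f → Orthonormal ℂ e →
    ∑ i, ‖∫ q : ℝ × ℝ, starRingEnd ℂ (f i q.1) * k q.1 q.2 * e i q.2 ∂(volume.prod volume)‖ ≤ H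

lemma NuclearKernel.add {k₁ k₂ : ℝ → ℝ → ℂ} {H₁ H₂ : ℝ} (h₁ : NuclearKernel k₁ H₁)
    (h₂ : NuclearKernel k₂ H₂) : NuclearKernel (fun x y => k₁ x y + k₂ x y) (H₁ + H₂) := by
  have hsplit : ∀ f e : L2R,
      (fun q : ℝ × ℝ => starRingEnd ℂ (f q.1) * (k₁ q.1 q.2 + k₂ q.1 q.2) * e q.2) = fun q =>
        starRingEnd ℂ (f q.1) * k₁ q.1 q.2 * e q.2 + starRingEnd ℂ (f q.1) * k₂ q.1 q.2 * e q.2 :=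
    fun f e => by ext q; ring
  refine ⟨fun f e => ?_, fun n f e hf he => ?_⟩
  · rw [hsplit]
    exact (h₁.integrable f e).add (h₂.integrable f e)
  · refine le_trans ?_ (add_le_add (h₁.sum_le n f e hf he) (h₂.sum_le n f e hf he))
    rw [← Finset.sum_add_distrib]
    refine Finset.sum_le_sum fun i _ => ?_
    rw [hsplit, integral_add (h₁.integrable _ _) (h₂.integrable _ _)]
    exact norm_add_le _ _

lemma NuclearKernel.mono {k : ℝ → ℝ → ℂ} {H H' : ℝ} (h : NuclearKernel k H) (hH : H ≤ H') :
    NuclearKernel k H' :=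
  ⟨h.integrable, fun n f e hf he => (h.sum_le n f e hf he).trans hH⟩

/-- Bessel's inequality for the pairings of a function dominated by an `L²` function with an
orthonormal family. -/
lemma sum_norm_integral_conj_mul_sq_le {n : ℕ} {f : Fin n → L2R} (hf : Orthonormal ℂ f)
    {w : ℝ → ℂ} (hw : AEStronglyMeasurable w volume) {U : ℝ → ℝ} (hU : MemLp U 2 volume) {c : ℝ}
    (hwU : ∀ x, ‖w x‖ ≤ c * ‖U x‖) :
    ∑ i, ‖∫ x, starRingEnd ℂ (f i x) * w x‖ ^ 2 ≤ (c * (eLpNorm U 2 volume).toReal) ^ 2 := by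
  have hw2 : MemLp w 2 volume := hU.of_le_mul hw (Eventually.of_forall hwU)
  have h1 : ∀ i, ∫ x, starRingEnd ℂ (f i x) * w x = inner ℂ (f i) (hw2.toLp w) := by
    intro i
    rw [MeasureTheory.L2.inner_def]
    refine integral_congr_ae ?_
    filter_upwards [hw2.coeFn_toLp] with x hx
    rw [hx, RCLike.inner_apply, mul_comm]
  simp_rw [h1]
  refine (hf.sum_inner_products_le _).trans ?_
  have h2 : ‖hw2.toLp w‖ ≤ c * ‖hU.toLp U‖ := by
    refine Lp.norm_le_mul_norm_of_ae_le_mul ?_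
    filter_upwards [hw2.coeFn_toLp, hU.coeFn_toLp] with x hx hx'
    rw [hx, hx']
    exact hwU x
  rw [Lp.norm_toLp U hU] at h2
  exact pow_le_pow_left₀ (norm_nonneg _) h2 2

lemma sum_norm_integral_mul_sq_le {n : ℕ} {e : Fin n → L2R} (he : Orthonormal ℂ e)
    {w : ℝ → ℂ} (hw : AEStronglyMeasurable w volume) {U : ℝ → ℝ} (hU : MemLp U 2 volume) {c : ℝ}
    (hwU : ∀ x, ‖w x‖ ≤ c * ‖U x‖) :
    ∑ i, ‖∫ x, w x * e i x‖ ^ 2 ≤ (c * (eLpNorm U 2 volume).toReal) ^ 2 := by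
  have h := sum_norm_integral_conj_mul_sq_le he (w := fun x => starRingEnd ℂ (w x))
    (Complex.continuous_conj.comp_aestronglyMeasurable hw) hU (c := c) (by simpa using hwU)
  convert h using 3 with i
  rw [← Complex.norm_conj, ← integral_conj]
  congr 2
  ext x
  simp [mul_comm]

/-- A superposition of rank one kernels `u z x * v z y`. -/
lemma NuclearKernel.of_integral {Z : Type*} [MeasurableSpace Z] (ν : Measure Z) [SFinite ν]
    {u v : Z → ℝ → ℂ} (hu : Measurable (Function.uncurry u)) (hv : Measurable (Function.uncurry v))
    {h₁ h₂ : Z → ℝ} (h₁0 : ∀ z, 0 ≤ h₁ z) (h₂0 : ∀ z, 0 ≤ h₂ z)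
    (hh : Integrable (fun z => h₁ z * h₂ z) ν)
    {U V : ℝ → ℝ} (hU : MemLp U 2 volume) (hV : MemLp V 2 volume)
    (huU : ∀ᵐ z ∂ν, ∀ x, ‖u z x‖ ≤ h₁ z * ‖U x‖) (hvV : ∀ᵐ z ∂ν, ∀ y, ‖v z y‖ ≤ h₂ z * ‖V y‖) :
    NuclearKernel (fun x y => ∫ z, u z x * v z y ∂ν)
      ((∫ z, h₁ z * h₂ z ∂ν) * ((eLpNorm U 2 volume).toReal * (eLpNorm V 2 volume).toReal)) := by
  have hmeas : ∀ f : L2R, Measurable (f : ℝ → ℂ) := fun f => (Lp.stronglyMeasurable f).measurable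
  have hint : ∀ f e : L2R, Integrable (fun p : Z × ℝ × ℝ =>
      (starRingEnd ℂ (f p.2.1) * u p.1 p.2.1) * (v p.1 p.2.2 * e p.2.2))
      (ν.prod (volume.prod volume)) := by
    intro f e
    have hf1 : Integrable (fun x => ‖f x‖ * ‖U x‖) volume :=
      (Lp.memLp f).norm.integrable_mul hU.norm
    have he1 : Integrable (fun x => ‖V x‖ * ‖e x‖) volume :=
      hV.norm.integrable_mul (Lp.memLp e).norm
    refine (hh.mul_prod (hf1.mul_prod he1)).mono' ?_ ?_
    · have m1 : Measurable fun p : Z × ℝ × ℝ => u p.1 p.2.1 :=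
        hu.comp (measurable_fst.prodMk measurable_snd.fst)
      have m2 : Measurable fun p : Z × ℝ × ℝ => v p.1 p.2.2 :=
        hv.comp (measurable_fst.prodMk measurable_snd.snd)
      have m3 : Measurable fun p : Z × ℝ × ℝ => starRingEnd ℂ (f p.2.1) :=
        Complex.continuous_conj.measurable.comp ((hmeas f).comp measurable_snd.fst)
      have m4 : Measurable fun p : Z × ℝ × ℝ => e p.2.2 := (hmeas e).comp measurable_snd.snd
      exact ((m3.mul m1).mul (m2.mul m4)).aestronglyMeasurable
    · filter_upwards [Measure.quasiMeasurePreserving_fst.ae huU,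
        Measure.quasiMeasurePreserving_fst.ae hvV] with p hp hp'
      rw [norm_mul, norm_mul, norm_mul, RCLike.norm_conj]
      calc ‖f p.2.1‖ * ‖u p.1 p.2.1‖ * (‖v p.1 p.2.2‖ * ‖e p.2.2‖)
          ≤ ‖f p.2.1‖ * (h₁ p.1 * ‖U p.2.1‖) * ((h₂ p.1 * ‖V p.2.2‖) * ‖e p.2.2‖) := by
            have := h₁0 p.1
            have := h₂0 p.1
            gcongr
            · exact hp _
            · exact hp' _
        _ = _ := by ring
  have heq : ∀ f e : L2R, (fun q : ℝ × ℝ =>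
      starRingEnd ℂ (f q.1) * (∫ z, u z q.1 * v z q.2 ∂ν) * e q.2) = fun q =>
        ∫ z, (starRingEnd ℂ (f q.1) * u z q.1) * (v z q.2 * e q.2) ∂ν := by
    intro f e
    ext q
    rw [← integral_const_mul, ← integral_mul_const]
    congr 1
    ext z
    ring
  refine ⟨fun f e => ?_, fun n f e hf he => ?_⟩
  · rw [heq]
    exact (hint f e).integral_prod_right
  · have hI : ∀ i, ∫ q : ℝ × ℝ, starRingEnd ℂ (f i q.1) * (∫ z, u z q.1 * v z q.2 ∂ν) * e i q.2
        ∂(volume.prod volume) =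
        ∫ z, (∫ x, starRingEnd ℂ (f i x) * u z x) * (∫ y, v z y * e i y) ∂ν := by
      intro i
      rw [heq, ← integral_integral_swap (hint (f i) (e i))]
      congr 1
      ext z
      exact integral_prod_mul (fun x => starRingEnd ℂ (f i x) * u z x) (fun y => v z y * e i y)
    have hIint : ∀ i, Integrable (fun z =>
        (∫ x, starRingEnd ℂ (f i x) * u z x) * (∫ y, v z y * e i y)) ν := by
      intro i
      refine (hint (f i) (e i)).integral_prod_left.congr (Eventually.of_forall fun z => ?_)
      exact integral_prod_mul (fun x => starRingEnd ℂ (f i x) * u z x) (fun y => v z y * e i y)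
    simp only [hI]
    calc _ ≤ ∑ i, ∫ z, ‖(∫ x, starRingEnd ℂ (f i x) * u z x) * (∫ y, v z y * e i y)‖ ∂ν :=
          Finset.sum_le_sum fun i _ => norm_integral_le_integral_norm _
      _ = ∫ z, ∑ i, ‖(∫ x, starRingEnd ℂ (f i x) * u z x) * (∫ y, v z y * e i y)‖ ∂ν :=
          (integral_finsetSum _ fun i _ => (hIint i).norm).symm
      _ ≤ ∫ z, h₁ z * h₂ z * ((eLpNorm U 2 volume).toReal * (eLpNorm V 2 volume).toReal) ∂ν := by
          refine integral_mono_ae (integrable_finsetSum _ fun i _ => (hIint i).norm)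
            (hh.mul_const _) ?_
          filter_upwards [huU, hvV] with z hz hz'
          have hP := sum_norm_integral_conj_mul_sq_le hf
            (hu.of_uncurry_left (x := z)).aestronglyMeasurable hU hz
          have hQ := sum_norm_integral_mul_sq_le he
            (hv.of_uncurry_left (x := z)).aestronglyMeasurable hV hz'
          simp only [norm_mul]
          refine (Real.sum_mul_le_sqrt_mul_sqrt _ _ _).trans ?_
          have hP' := Real.sqrt_le_sqrt hP
          have hQ' := Real.sqrt_le_sqrt hQ
          rw [Real.sqrt_sq (mul_nonneg (h₁0 z) ENNReal.toReal_nonneg)] at hP'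
          rw [Real.sqrt_sq (mul_nonneg (h₂0 z) ENNReal.toReal_nonneg)] at hQ'
          refine (mul_le_mul hP' hQ' (Real.sqrt_nonneg _)
            (mul_nonneg (h₁0 z) ENNReal.toReal_nonneg)).trans (le_of_eq (by ring))
      _ = _ := integral_mul_const _ _

/-- An operator given weakly by a nuclear kernel is of trace class. -/
lemma NuclearKernel.traceNorm_le {k : ℝ → ℝ → ℂ} {H : ℝ} (hk : NuclearKernel k H)
    (A : L2R →L[ℂ] L2R) (hA : HasKernel A k) : traceNorm A ≤ ENNReal.ofReal (2 * H) := by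
  refine traceNorm_le_of_sum_inner_le A H fun n e f he hf => ?_
  refine le_of_eq_of_le (Finset.sum_congr rfl fun i _ => ?_) (hk.sum_le n f e hf he)
  rw [integral_prod _ (hk.integrable (f i) (e i)), MeasureTheory.L2.inner_def]
  congr 1
  refine integral_congr_ae ?_
  filter_upwards [hA (e i)] with x hx
  rw [hx, RCLike.inner_apply, mul_comm, ← integral_const_mul]
  simp only [mul_assoc]

end NuclearKernels

section Weights

/-- The weight `(1 + |x - p|) ^ (-s)`. -/
def decayWeight (s p x : ℝ) : ℝ := (1 + |x - p|) ^ (-s)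

lemma decayWeight_nonneg (s p x : ℝ) : 0 ≤ decayWeight s p x :=
  Real.rpow_nonneg (by positivity) _

lemma decayWeight_le_one {s : ℝ} (hs : 0 ≤ s) (p x : ℝ) : decayWeight s p x ≤ 1 :=
  Real.rpow_le_one_of_one_le_of_nonpos (by linarith [abs_nonneg (x - p)]) (by linarith)

lemma measurable_decayWeight (s p : ℝ) : Measurable (decayWeight s p) := by
  unfold decayWeight
  fun_prop

lemma integrable_decayWeight {s : ℝ} (hs : 1 < s) (p : ℝ) : Integrable (decayWeight s p) := by
  have h : Integrable (fun x : ℝ => (1 + ‖x‖) ^ (-s)) := integrable_one_add_norm (by simpa using hs)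
  exact h.comp_sub_right p

lemma integral_decayWeight (s p : ℝ) : ∫ x, decayWeight s p x = ∫ x, decayWeight s 0 x := by
  rw [← integral_sub_right_eq_self (decayWeight s 0) p]
  simp [decayWeight]

lemma memLp_decayWeight (p : ℝ) : MemLp (decayWeight (3 / 4) p) 2 volume := by
  rw [memLp_two_iff_integrable_sq (measurable_decayWeight _ _).aestronglyMeasurable]
  have hsq : (fun x => decayWeight (3 / 4) p x ^ 2) = decayWeight (3 / 2) p := by
    ext x
    rw [decayWeight, decayWeight, ← Real.rpow_natCast, ← Real.rpow_mul (by positivity)]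
    norm_num
  rw [hsq]
  exact integrable_decayWeight (by norm_num) p

lemma eLpNorm_decayWeight (s p : ℝ) :
    eLpNorm (decayWeight s p) 2 volume = eLpNorm (decayWeight s 0) 2 volume := by
  rw [← eLpNorm_comp_measurePreserving (measurable_decayWeight s 0).aestronglyMeasurable
    (measurePreserving_sub_right volume p)]
  congr 1
  ext x
  simp [decayWeight]

lemma inv_rpow_le_of_le {D t s q : ℝ} (hs : 0 ≤ s) (h : 1 + s ≤ D * t) (hq : 0 ≤ q) :
    (D * t) ^ (-q) ≤ (1 + s) ^ (-q) :=
  Real.rpow_le_rpow_of_nonpos (by linarith) h (by linarith)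

/-- Two intervals `S`, `T` at distance at least `c`, with a point `p` in between. -/
structure Separated (c p : ℝ) (S T : Set ℝ) : Prop where
  le_abs : ∀ x ∈ S, ∀ z ∈ T, c ≤ |z - x|
  right_le : ∀ x ∈ S, ∀ z ∈ T, |z - p| ≤ |z - x|
  left_le : ∀ x ∈ S, ∀ z ∈ T, |x - p| ≤ |z - x|

lemma exists_separated {c : ℝ} (hc : 0 < c) {S T : Set ℝ} (hS : S.OrdConnected)
    (hT : T.OrdConnected) (hS0 : S.Nonempty) (hT0 : T.Nonempty)
    (h : ∀ x ∈ S, ∀ z ∈ T, c ≤ |z - x|) : ∃ p, Separated c p S T := by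
  obtain ⟨x₀, hx₀⟩ := hS0
  obtain ⟨z₀, hz₀⟩ := hT0
  have hdisj : ∀ x ∈ S, x ∉ T := fun x hx hx' => by
    have := h x hx x hx'
    simp at this
    linarith
  rcases lt_trichotomy x₀ z₀ with hlt | heq | hlt
  · have hord : ∀ x ∈ S, ∀ z ∈ T, x ≤ z := by
      intro x hx z hz
      by_contra! hzx
      rcases le_total z x₀ with h1 | h1
      · exact hdisj x₀ hx₀ (hT.out hz hz₀ ⟨h1, hlt.le⟩)
      · exact hdisj z (hS.out hx₀ hx ⟨h1, hzx.le⟩) hz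
    have hb : BddBelow T := ⟨x₀, fun z hz => hord x₀ hx₀ z hz⟩
    refine ⟨sInf T, h, fun x hx z hz => ?_, fun x hx z hz => ?_⟩
    all_goals
      have h1 : sInf T ≤ z := csInf_le hb hz
      have h2 : x ≤ sInf T := le_csInf ⟨z, hz⟩ (hord x hx)
      rw [abs_le]
      constructor <;> linarith [le_abs_self (z - x)]
  · exact absurd (heq ▸ hz₀) (hdisj x₀ hx₀)
  · have hord : ∀ x ∈ S, ∀ z ∈ T, z ≤ x := by
      intro x hx z hz
      by_contra! hzx
      rcases le_total z x₀ with h1 | h1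
      · exact hdisj z (hS.out hx hx₀ ⟨hzx.le, h1⟩) hz
      · exact hdisj x₀ hx₀ (hT.out hz₀ hz ⟨hlt.le, h1⟩)
    have hb : BddAbove T := ⟨x₀, fun z hz => hord x₀ hx₀ z hz⟩
    refine ⟨sSup T, h, fun x hx z hz => ?_, fun x hx z hz => ?_⟩
    all_goals
      have h1 : z ≤ sSup T := le_csSup hb hz
      have h2 : sSup T ≤ x := csSup_le ⟨z, hz⟩ (hord x hx)
      rw [abs_le]
      constructor <;> linarith [neg_abs_le (z - x)]

namespace Separated

variable {c p : ℝ} {S T : Set ℝ}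

lemma closure_right (h : Separated c p S T) : Separated c p S (closure T) := by
  refine ⟨fun x hx => ?_, fun x hx => ?_, fun x hx => ?_⟩
  · exact closure_minimal (t := {z | c ≤ |z - x|}) (h.le_abs x hx)
      (isClosed_le (by fun_prop) (by fun_prop))
  · exact closure_minimal (t := {z | |z - p| ≤ |z - x|}) (h.right_le x hx)
      (isClosed_le (by fun_prop) (by fun_prop))
  · exact closure_minimal (t := {z | |x - p| ≤ |z - x|}) (h.left_le x hx)
      (isClosed_le (by fun_prop) (by fun_prop))

variable {x z : ℝ}

lemma sub_ne_zero (h : Separated c p S T) (hc : 0 < c) (hx : x ∈ S) (hz : z ∈ T) :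
    (z : ℂ) - x ≠ 0 := by
  have h1 := h.le_abs x hx z hz
  rw [← Complex.ofReal_sub, Complex.ofReal_ne_zero, ← abs_pos]
  linarith

lemma one_add_right_le (h : Separated c p S T) (hc : 0 < c) (hx : x ∈ S) (hz : z ∈ T) :
    1 + |z - p| ≤ (1 + c⁻¹) * |z - x| := by
  have h1 : 1 ≤ c⁻¹ * |z - x| := by
    rw [inv_mul_eq_div, le_div_iff₀ hc]
    linarith [h.le_abs x hx z hz]
  linarith [h.right_le x hx z hz]

lemma one_add_left_le (h : Separated c p S T) (hc : 0 < c) (hx : x ∈ S) (hz : z ∈ T) :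
    1 + |x - p| ≤ (1 + c⁻¹) * |z - x| := by
  have h1 : 1 ≤ c⁻¹ * |z - x| := by
    rw [inv_mul_eq_div, le_div_iff₀ hc]
    linarith [h.le_abs x hx z hz]
  linarith [h.left_le x hx z hz]

lemma inv_rpow_le (h : Separated c p S T) (hc : 0 < c) (hx : x ∈ S) (hz : z ∈ T)
    {q r : ℝ} (hq : 0 ≤ q) (hr : 0 ≤ r) :
    (((1 + c⁻¹) * |z - x|)⁻¹) ^ (q + r) ≤ decayWeight q p z * decayWeight r p x := by
  have h0 : 0 < (1 + c⁻¹) * |z - x| :=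
    lt_of_lt_of_le (by positivity) (h.one_add_right_le hc hx hz)
  rw [Real.inv_rpow h0.le, ← Real.rpow_neg h0.le, neg_add, Real.rpow_add h0]
  exact mul_le_mul (inv_rpow_le_of_le (abs_nonneg _) (h.one_add_right_le hc hx hz) hq)
    (inv_rpow_le_of_le (abs_nonneg _) (h.one_add_left_le hc hx hz) hr)
    (Real.rpow_nonneg h0.le _) (decayWeight_nonneg _ _ _)

lemma norm_inv_le (h : Separated c p S T) (hc : 0 < c) (hx : x ∈ S) (hz : z ∈ T)
    {q r : ℝ} (hq : 0 ≤ q) (hr : 0 ≤ r) (hqr : q + r = 1) :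
    ‖((z : ℂ) - x)⁻¹‖ ≤ (1 + c⁻¹) * (decayWeight q p z * decayWeight r p x) := by
  have h1 := h.inv_rpow_le hc hx hz hq hr
  rw [hqr, Real.rpow_one, mul_inv, inv_mul_eq_div, div_le_iff₀' (by positivity)] at h1
  rwa [← Complex.ofReal_sub, norm_inv, Complex.norm_real, Real.norm_eq_abs]

lemma norm_inv_sq_le (h : Separated c p S T) (hc : 0 < c) (hx : x ∈ S) (hz : z ∈ T) :
    ‖(((z : ℂ) - x) ^ 2)⁻¹‖ ≤
      (1 + c⁻¹) ^ 2 * (decayWeight (5 / 4) p z * decayWeight (3 / 4) p x) := by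
  have h1 := h.inv_rpow_le hc hx hz (q := 5 / 4) (r := 3 / 4) (by norm_num) (by norm_num)
  rw [show (5 / 4 + 3 / 4 : ℝ) = (2 : ℕ) by norm_num, Real.rpow_natCast, inv_pow, mul_pow,
    mul_inv, inv_mul_eq_div, div_le_iff₀' (by positivity)] at h1
  rwa [← Complex.ofReal_sub, norm_inv, norm_pow, Complex.norm_real, Real.norm_eq_abs]

lemma norm_inv_le_decayWeight (h : Separated c p S T) (hc : 0 < c) (hx : x ∈ S) (hz : z ∈ T) :
    ‖((z : ℂ) - x)⁻¹‖ ≤ (1 + c⁻¹) * decayWeight (3 / 4) p x := by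
  have h1 := h.norm_inv_le hc hx hz (q := 1 / 4) (r := 3 / 4) (by norm_num) (by norm_num)
    (by norm_num)
  refine h1.trans (mul_le_mul_of_nonneg_left ?_ (by positivity))
  exact mul_le_of_le_one_left (decayWeight_nonneg _ _ _) (decayWeight_le_one (by norm_num) _ _)

end Separated

lemma integrable_decayWeight_mul (p p' : ℝ) :
    Integrable (fun z => decayWeight 1 p z * decayWeight (1 / 4) p' z) := by
  refine ((integrable_decayWeight (show (1 : ℝ) < 5 / 4 by norm_num) p).add
    (integrable_decayWeight (show (1 : ℝ) < 5 / 4 by norm_num) p')).mono'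
    ((measurable_decayWeight _ _).mul (measurable_decayWeight _ _)).aestronglyMeasurable
    (Eventually.of_forall fun z => ?_)
  rw [Real.norm_of_nonneg (mul_nonneg (decayWeight_nonneg _ _ _) (decayWeight_nonneg _ _ _))]
  have hsplit : ∀ p : ℝ, decayWeight (5 / 4) p z = decayWeight 1 p z * decayWeight (1 / 4) p z := by
    intro p
    rw [decayWeight, decayWeight, decayWeight, ← Real.rpow_add (by positivity)]
    norm_num
  have hmono : ∀ {s p p' : ℝ}, 0 ≤ s → |z - p| ≤ |z - p'| →
      decayWeight s p' z ≤ decayWeight s p z := by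
    intro s p p' hs hpp
    exact Real.rpow_le_rpow_of_nonpos (by positivity) (by linarith) (by linarith)
  simp only [Pi.add_apply]
  rcases le_total |z - p| |z - p'| with h | h
  · have := mul_le_mul_of_nonneg_left (hmono (s := 1 / 4) (by norm_num) h)
      (decayWeight_nonneg 1 p z)
    linarith [hsplit p, decayWeight_nonneg (5 / 4) p' z]
  · have := mul_le_mul_of_nonneg_right (hmono (s := 1) (by norm_num) h)
      (decayWeight_nonneg (1 / 4) p' z)
    linarith [hsplit p', decayWeight_nonneg (5 / 4) p z]

end Weights

section BoundaryTerms

lemma exists_setIntegral_eq_boundary {J : Set ℝ} (hJ : J.OrdConnected) (hc : IsClosed J)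
    (hne : J.Nonempty) (huniv : J ≠ Set.univ) :
    ∃ a ∈ J, ∃ b ∈ J, ∃ α β : ℂ, ‖α‖ ≤ 1 ∧ ‖β‖ ≤ 1 ∧ ∀ F F' : ℝ → ℂ,
      (∀ z ∈ J, HasDerivAt F (F' z) z) → IntegrableOn F' J → Tendsto F (cocompact ℝ) (𝓝 0) →
      ∫ z in J, F' z = β * F b + α * F a := by
  by_cases hb : BddBelow J <;> by_cases ha : BddAbove J
  · have h1 := hc.csInf_mem hne hb
    have h2 := hc.csSup_mem hne ha
    have hJeq : J = Set.Icc (sInf J) (sSup J) :=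
      Set.Subset.antisymm (fun z hz => ⟨csInf_le hb hz, le_csSup ha hz⟩) (hJ.out h1 h2)
    have hle : sInf J ≤ sSup J := csInf_le hb h2
    refine ⟨sInf J, h1, sSup J, h2, -1, 1, by simp, by simp, fun F F' hF hint _ => ?_⟩
    generalize sInf J = a at *
    generalize sSup J = b at *
    subst hJeq
    rw [integral_Icc_eq_integral_Ioc, ← intervalIntegral.integral_of_le hle,
      intervalIntegral.integral_eq_sub_of_hasDerivAt (f := F) (by rwa [Set.uIcc_of_le hle])]
    · ring
    · rw [intervalIntegrable_iff_integrableOn_Icc_of_le hle]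
      exact hint
  · have h1 := hc.csInf_mem hne hb
    have hJeq : J = Set.Ici (sInf J) := by
      refine Set.Subset.antisymm (fun z hz => csInf_le hb hz) fun z hz => ?_
      obtain ⟨y, hy, hzy⟩ := not_bddAbove_iff.mp ha z
      exact hJ.out h1 hy ⟨hz, hzy.le⟩
    refine ⟨sInf J, h1, sInf J, h1, -1, 0, by simp, by simp, fun F F' hF hint hlim => ?_⟩
    generalize sInf J = a at *
    subst hJeq
    rw [integral_Ici_eq_integral_Ioi, integral_Ioi_of_hasDerivAt_of_tendsto
      (hF a h1).continuousAt.continuousWithinAt (fun z hz => hF z (Set.mem_Ioi.mp hz).le)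
      (hint.mono_set Set.Ioi_subset_Ici_self) (hlim.mono_left atTop_le_cocompact)]
    ring
  · have h2 := hc.csSup_mem hne ha
    have hJeq : J = Set.Iic (sSup J) := by
      refine Set.Subset.antisymm (fun z hz => le_csSup ha hz) fun z hz => ?_
      obtain ⟨y, hy, hzy⟩ := not_bddBelow_iff.mp hb z
      exact hJ.out hy h2 ⟨hzy.le, hz⟩
    refine ⟨sSup J, h2, sSup J, h2, 1, 0, by simp, by simp, fun F F' hF hint hlim => ?_⟩
    generalize sSup J = a at *
    subst hJeq
    rw [integral_Iic_of_hasDerivAt_of_tendsto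
      (hF a h2).continuousAt.continuousWithinAt (fun z hz => hF z (Set.mem_Iio.mp hz).le)
      hint (hlim.mono_left atBot_le_cocompact)]
    ring
  · refine absurd (Set.eq_univ_of_forall fun z => ?_) huniv
    obtain ⟨y, hy, hzy⟩ := not_bddAbove_iff.mp ha z
    obtain ⟨y', hy', hzy'⟩ := not_bddBelow_iff.mp hb z
    exact hJ.out hy' hy ⟨hzy'.le, hzy.le⟩

lemma tendsto_inv_ofReal_sub_cocompact (x : ℝ) :
    Tendsto (fun z : ℝ => ((z : ℂ) - x)⁻¹) (cocompact ℝ) (𝓝 0) := by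
  have h : Tendsto (fun z : ℝ => (z - x)⁻¹) (cocompact ℝ) (𝓝 0) := by
    rw [← Metric.cobounded_eq_cocompact]
    exact tendsto_inv₀_cobounded.comp (tendsto_sub_const_cobounded x)
  have := (Complex.continuous_ofReal.tendsto 0).comp h
  simpa [Function.comp_def] using this

end BoundaryTerms

section AlmostPeriodic

/-- The oscillating part of an almost periodic function with no small frequencies has a bounded
antiderivative. -/
lemma exists_bounded_antiderivative (Θ : Set ℝ) (a : ℝ → ℂ) (hsupp : ∀ θ : ℝ, θ ∉ Θ → a θ = 0)
    (hsum : Summable fun θ : ↥(Θ \ {(0:ℝ)}) => ‖a θ‖ * (1 + |(θ : ℝ)|⁻¹))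
    (f : ℝ → ℂ) (hf : ∀ x : ℝ, f x = ∑' θ : ↥Θ, a θ * Complex.exp (Complex.I * θ * x)) :
    ∃ (G : ℝ → ℂ) (M : ℝ), 0 ≤ M ∧ (∀ x, HasDerivAt G (f x - a 0) x) ∧ (∀ x, ‖G x‖ ≤ M) ∧
      ∀ x, ‖f x‖ ≤ M := by
  classical
  set b : ℝ → ℂ := fun θ => if θ = 0 then 0 else a θ with hb
  have hsum' : Summable fun θ : ℝ => ‖b θ‖ * (1 + |θ|⁻¹) := by
    have h1 := (summable_subtype_iff_indicator (s := Θ \ {(0:ℝ)})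
      (f := fun θ : ℝ => ‖a θ‖ * (1 + |θ|⁻¹))).mp hsum
    convert h1 using 2 with θ
    by_cases h0 : θ = 0
    · simp [hb, h0]
    · by_cases hθ : θ ∈ Θ
      · simp [hb, h0, hθ, Set.indicator]
      · simp [hb, h0, hθ, hsupp θ hθ, Set.indicator]
  have hexp : ∀ θ x : ℝ, ‖Complex.exp (Complex.I * θ * x)‖ = 1 := by
    intro θ x
    rw [show Complex.I * θ * x = ((θ * x : ℝ) : ℂ) * Complex.I by push_cast; ring]
    exact Complex.norm_exp_ofReal_mul_I _
  have hb1 : Summable fun θ : ℝ => ‖b θ‖ := by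
    refine hsum'.of_nonneg_of_le (fun θ => norm_nonneg _) fun θ => ?_
    nlinarith [norm_nonneg (b θ), inv_nonneg.mpr (abs_nonneg θ),
      mul_nonneg (norm_nonneg (b θ)) (inv_nonneg.mpr (abs_nonneg θ))]
  have hb2 : Summable fun θ : ℝ => ‖b θ‖ * |θ|⁻¹ := by
    refine hsum'.of_nonneg_of_le (fun θ => by positivity) fun θ => ?_
    nlinarith [norm_nonneg (b θ)]
  have hsplit : ∀ x, f x = a 0 + ∑' θ : ℝ, b θ * Complex.exp (Complex.I * θ * x) := by
    intro x
    have hs : Summable fun θ : ℝ => b θ * Complex.exp (Complex.I * θ * x) :=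
      Summable.of_norm (by simpa [hexp] using hb1)
    have hs0 : HasSum (fun θ : ℝ => if θ = 0 then a 0 else 0) (a 0) := hasSum_ite_eq 0 (a 0)
    rw [hf, tsum_subtype_eq_of_support_subset (f := fun θ : ℝ =>
      a θ * Complex.exp (Complex.I * θ * x)) (s := Θ), ← (hs0.add hs.hasSum).tsum_eq]
    · congr 1
      ext θ
      by_cases h0 : θ = 0 <;> simp [hb, h0]
    · intro θ hθ
      by_contra h
      simp [hsupp θ h] at hθ
  set G : ℝ → ℂ := fun x =>
    ∑' θ : ℝ, b θ * (Complex.I * θ)⁻¹ * Complex.exp (Complex.I * θ * x) with hG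
  have hterm : ∀ θ x : ℝ,
      ‖b θ * (Complex.I * θ)⁻¹ * Complex.exp (Complex.I * θ * x)‖ = ‖b θ‖ * |θ|⁻¹ := by
    intro θ x
    simp [hexp]
  have hGs : ∀ x : ℝ, Summable fun θ : ℝ =>
      b θ * (Complex.I * θ)⁻¹ * Complex.exp (Complex.I * θ * x) := fun x =>
    Summable.of_norm (by simpa only [hterm] using hb2)
  have h0 : 0 ≤ ∑' θ : ℝ, ‖b θ‖ := tsum_nonneg fun θ => norm_nonneg _
  have h0' : 0 ≤ ∑' θ : ℝ, ‖b θ‖ * |θ|⁻¹ := tsum_nonneg fun θ => by positivity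
  refine ⟨G, (∑' θ : ℝ, ‖b θ‖ * |θ|⁻¹) + (‖a 0‖ + ∑' θ : ℝ, ‖b θ‖), by positivity,
    fun x => ?_, fun x => ?_, fun x => ?_⟩
  · rw [hsplit, add_sub_cancel_left]
    refine hasDerivAt_tsum (u := fun θ => ‖b θ‖) hb1
      (g' := fun (θ : ℝ) (x : ℝ) => b θ * Complex.exp (Complex.I * θ * x)) (fun θ y => ?_)
      (fun θ y => by simp [hexp]) (hGs 0) x
    by_cases hθ : θ = 0
    · simpa [hb, hθ] using hasDerivAt_const y (0 : ℂ)
    · have h1 : HasDerivAt (fun y : ℝ => Complex.I * θ * (y : ℂ)) (Complex.I * θ) y := by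
        simpa using (Complex.ofRealCLM.hasDerivAt (x := y)).const_mul (Complex.I * (θ : ℂ))
      have h2 := h1.cexp.const_mul (b θ * (Complex.I * θ)⁻¹)
      have hI : Complex.I * (θ : ℂ) ≠ 0 := mul_ne_zero Complex.I_ne_zero (by exact_mod_cast hθ)
      refine h2.congr_deriv ?_
      rw [mul_comm (Complex.exp _), mul_assoc, inv_mul_cancel_left₀ hI]
  · have : ‖G x‖ ≤ ∑' θ : ℝ, ‖b θ‖ * |θ|⁻¹ :=
      tsum_of_norm_bounded hb2.hasSum fun θ => (hterm θ x).le
    linarith [norm_nonneg (a 0)]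
  · have : ‖∑' θ : ℝ, b θ * Complex.exp (Complex.I * θ * x)‖ ≤ ∑' θ : ℝ, ‖b θ‖ :=
      tsum_of_norm_bounded hb1.hasSum fun θ => by simp [hexp]
    rw [hsplit]
    linarith [norm_add_le (a 0) (∑' θ : ℝ, b θ * Complex.exp (Complex.I * θ * x))]

end AlmostPeriodic

section SeparatedKernels

lemma norm_indicator_one_mul_le {S : Set ℝ} {x : ℝ} {w : ℂ} {B : ℝ} (hB : 0 ≤ B)
    (h : x ∈ S → ‖w‖ ≤ B) : ‖Set.indicator S (fun _ => (1 : ℂ)) x * w‖ ≤ B := by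
  by_cases hx : x ∈ S <;> simp [hx, hB, h]

variable {c p p' M : ℝ} {I J K : Set ℝ} {G : ℝ → ℂ}

/-- The common `L²` norm of the weights `(1 + |x - p|) ^ (-3/4)`. -/
def weightNorm : ℝ := (eLpNorm (decayWeight (3 / 4) 0) 2 volume).toReal

lemma toReal_eLpNorm_decayWeight (p : ℝ) :
    (eLpNorm (decayWeight (3 / 4) p) 2 volume).toReal = weightNorm := by
  rw [eLpNorm_decayWeight, weightNorm]

lemma nuclearKernel_boundary (hc : 0 < c) (hI : I.OrdConnected) (hK : K.OrdConnected)
    (hIJ : Separated c p I J) (hKJ : Separated c p' K J) (hM : ∀ z, ‖G z‖ ≤ M) {b : ℝ}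
    (hb : b ∈ J) {β : ℂ} (hβ : ‖β‖ ≤ 1) :
    NuclearKernel (fun x y => Set.indicator I (fun _ => (1 : ℂ)) x *
        Set.indicator K (fun _ => (1 : ℂ)) y * (β * (G b / (((b : ℂ) - x) * ((b : ℂ) - y)))))
      (M * (1 + c⁻¹) * (1 + c⁻¹) * (weightNorm * weightNorm)) := by
  have hM0 : 0 ≤ M := (norm_nonneg _).trans (hM 0)
  have mI : Measurable (Set.indicator I (fun _ => (1 : ℂ))) :=
    measurable_const.indicator hI.measurableSet
  have mK : Measurable (Set.indicator K (fun _ => (1 : ℂ))) :=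
    measurable_const.indicator hK.measurableSet
  have key := NuclearKernel.of_integral (Measure.dirac ())
    (u := fun _ x => Set.indicator I (fun _ => (1 : ℂ)) x * (β * G b * ((b : ℂ) - x)⁻¹))
    (v := fun _ y => Set.indicator K (fun _ => (1 : ℂ)) y * ((b : ℂ) - y)⁻¹)
    (h₁ := fun _ => M * (1 + c⁻¹)) (h₂ := fun _ => 1 + c⁻¹)
    (U := decayWeight (3 / 4) p) (V := decayWeight (3 / 4) p')
    (by simp only [Function.uncurry_def]; fun_prop) (by simp only [Function.uncurry_def]; fun_prop)
    (fun _ => by positivity) (fun _ => by positivity) (integrable_const _)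
    (memLp_decayWeight p) (memLp_decayWeight p')
    (Eventually.of_forall fun _ x => by
      refine norm_indicator_one_mul_le (by positivity) fun hx => ?_
      rw [norm_mul, norm_mul, Real.norm_of_nonneg (decayWeight_nonneg _ _ _)]
      have h1 := hIJ.norm_inv_le_decayWeight hc hx hb
      have h2 : ‖β‖ * ‖G b‖ ≤ 1 * M := mul_le_mul hβ (hM b) (norm_nonneg _) zero_le_one
      rw [one_mul] at h2
      exact (mul_le_mul h2 h1 (norm_nonneg _) hM0).trans (le_of_eq (by ring)))
    (Eventually.of_forall fun _ y => by
      refine norm_indicator_one_mul_le (by positivity) fun hy => ?_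
      rw [Real.norm_of_nonneg (decayWeight_nonneg _ _ _)]
      exact hKJ.norm_inv_le_decayWeight hc hy hb)
  simp only [integral_dirac] at key
  rw [toReal_eLpNorm_decayWeight p, toReal_eLpNorm_decayWeight p'] at key
  convert key using 3
  rw [div_eq_mul_inv, mul_inv]
  ring

lemma setIntegral_decayWeight_le (a p : ℝ) (ha : 0 ≤ a) (J : Set ℝ) :
    ∫ z in J, a * decayWeight (5 / 4) p z ≤ a * ∫ z, decayWeight (5 / 4) 0 z := by
  rw [integral_const_mul, ← integral_decayWeight _ p]
  refine mul_le_mul_of_nonneg_left ?_ ha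
  exact setIntegral_le_integral (integrable_decayWeight (by norm_num) p)
    (Eventually.of_forall fun z => decayWeight_nonneg _ _ _)

lemma nuclearKernel_left_sq (hc : 0 < c) (hI : I.OrdConnected) (hJ : J.OrdConnected)
    (hK : K.OrdConnected)
    (hIJ : Separated c p I J) (hKJ : Separated c p' K J) (hG : Measurable G)
    (hM : ∀ z, ‖G z‖ ≤ M) :
    NuclearKernel (fun x y => Set.indicator I (fun _ => (1 : ℂ)) x *
        Set.indicator K (fun _ => (1 : ℂ)) y *
          ∫ z in J, G z / (((z : ℂ) - x) ^ 2 * ((z : ℂ) - y)))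
      (M * (1 + c⁻¹) ^ 3 * (∫ z, decayWeight (5 / 4) 0 z) * (weightNorm * weightNorm)) := by
  have hM0 : 0 ≤ M := (norm_nonneg _).trans (hM 0)
  have mI : Measurable (Set.indicator I (fun _ => (1 : ℂ))) :=
    measurable_const.indicator hI.measurableSet
  have mK : Measurable (Set.indicator K (fun _ => (1 : ℂ))) :=
    measurable_const.indicator hK.measurableSet
  have hint : Integrable (fun z => M * (1 + c⁻¹) ^ 2 * decayWeight (5 / 4) p z * (1 + c⁻¹))
      (volume.restrict J) :=
    (((integrable_decayWeight (by norm_num) p).const_mul _).mul_const _).restrict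
  have key := NuclearKernel.of_integral (volume.restrict J)
    (u := fun z x => Set.indicator I (fun _ => (1 : ℂ)) x * (G z * (((z : ℂ) - x) ^ 2)⁻¹))
    (v := fun z y => Set.indicator K (fun _ => (1 : ℂ)) y * ((z : ℂ) - y)⁻¹)
    (h₁ := fun z => M * (1 + c⁻¹) ^ 2 * decayWeight (5 / 4) p z) (h₂ := fun _ => 1 + c⁻¹)
    (U := decayWeight (3 / 4) p) (V := decayWeight (3 / 4) p')
    (by simp only [Function.uncurry_def]; fun_prop) (by simp only [Function.uncurry_def]; fun_prop)
    (fun _ => mul_nonneg (by positivity) (decayWeight_nonneg _ _ _)) (fun _ => by positivity)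
    hint (memLp_decayWeight p) (memLp_decayWeight p')
    (ae_restrict_of_forall_mem hJ.measurableSet fun z hz x => by
      refine norm_indicator_one_mul_le (mul_nonneg (mul_nonneg (by positivity)
        (decayWeight_nonneg _ _ _)) (norm_nonneg _)) fun hx => ?_
      rw [norm_mul, Real.norm_of_nonneg (decayWeight_nonneg _ _ _)]
      exact (mul_le_mul (hM z) (hIJ.norm_inv_sq_le hc hx hz) (norm_nonneg _) hM0).trans
        (le_of_eq (by ring)))
    (ae_restrict_of_forall_mem hJ.measurableSet fun z hz y => by
      refine norm_indicator_one_mul_le (by positivity) fun hy => ?_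
      rw [Real.norm_of_nonneg (decayWeight_nonneg _ _ _)]
      exact hKJ.norm_inv_le_decayWeight hc hy hz)
  rw [toReal_eLpNorm_decayWeight p, toReal_eLpNorm_decayWeight p'] at key
  have key' := key.mono (H' := M * (1 + c⁻¹) ^ 3 * (∫ z, decayWeight (5 / 4) 0 z) *
      (weightNorm * weightNorm)) (by
    refine mul_le_mul_of_nonneg_right ?_ (mul_self_nonneg _)
    refine le_trans (le_of_eq ?_) (setIntegral_decayWeight_le _ p (by positivity) J)
    congr 1
    ext z
    ring)
  convert key' using 3
  rw [← integral_const_mul]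
  congr 1
  ext z
  rw [div_eq_mul_inv, mul_inv]
  ring

lemma nuclearKernel_right_sq (hc : 0 < c) (hI : I.OrdConnected) (hJ : J.OrdConnected)
    (hK : K.OrdConnected)
    (hIJ : Separated c p I J) (hKJ : Separated c p' K J) (hG : Measurable G)
    (hM : ∀ z, ‖G z‖ ≤ M) :
    NuclearKernel (fun x y => Set.indicator I (fun _ => (1 : ℂ)) x *
        Set.indicator K (fun _ => (1 : ℂ)) y *
          ∫ z in J, G z / (((z : ℂ) - x) * ((z : ℂ) - y) ^ 2))
      (M * (1 + c⁻¹) ^ 3 * (∫ z, decayWeight (5 / 4) 0 z) * (weightNorm * weightNorm)) := by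
  have hM0 : 0 ≤ M := (norm_nonneg _).trans (hM 0)
  have mI : Measurable (Set.indicator I (fun _ => (1 : ℂ))) :=
    measurable_const.indicator hI.measurableSet
  have mK : Measurable (Set.indicator K (fun _ => (1 : ℂ))) :=
    measurable_const.indicator hK.measurableSet
  have hint : Integrable (fun z => (1 + c⁻¹) * (M * (1 + c⁻¹) ^ 2 * decayWeight (5 / 4) p' z))
      (volume.restrict J) :=
    (((integrable_decayWeight (by norm_num) p').const_mul _).const_mul _).restrict
  have key := NuclearKernel.of_integral (volume.restrict J)
    (u := fun z x => Set.indicator I (fun _ => (1 : ℂ)) x * ((z : ℂ) - x)⁻¹)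
    (v := fun z y => Set.indicator K (fun _ => (1 : ℂ)) y * (G z * (((z : ℂ) - y) ^ 2)⁻¹))
    (h₁ := fun _ => 1 + c⁻¹) (h₂ := fun z => M * (1 + c⁻¹) ^ 2 * decayWeight (5 / 4) p' z)
    (U := decayWeight (3 / 4) p) (V := decayWeight (3 / 4) p')
    (by simp only [Function.uncurry_def]; fun_prop) (by simp only [Function.uncurry_def]; fun_prop)
    (fun _ => by positivity) (fun _ => mul_nonneg (by positivity) (decayWeight_nonneg _ _ _))
    hint (memLp_decayWeight p) (memLp_decayWeight p')
    (ae_restrict_of_forall_mem hJ.measurableSet fun z hz x => by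
      refine norm_indicator_one_mul_le (by positivity) fun hx => ?_
      rw [Real.norm_of_nonneg (decayWeight_nonneg _ _ _)]
      exact hIJ.norm_inv_le_decayWeight hc hx hz)
    (ae_restrict_of_forall_mem hJ.measurableSet fun z hz y => by
      refine norm_indicator_one_mul_le (mul_nonneg (mul_nonneg (by positivity)
        (decayWeight_nonneg _ _ _)) (norm_nonneg _)) fun hy => ?_
      rw [norm_mul, Real.norm_of_nonneg (decayWeight_nonneg _ _ _)]
      exact (mul_le_mul (hM z) (hKJ.norm_inv_sq_le hc hy hz) (norm_nonneg _) hM0).trans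
        (le_of_eq (by ring)))
  rw [toReal_eLpNorm_decayWeight p, toReal_eLpNorm_decayWeight p'] at key
  have key' := key.mono (H' := M * (1 + c⁻¹) ^ 3 * (∫ z, decayWeight (5 / 4) 0 z) *
      (weightNorm * weightNorm)) (by
    refine mul_le_mul_of_nonneg_right ?_ (mul_self_nonneg _)
    refine le_trans (le_of_eq ?_) (setIntegral_decayWeight_le _ p' (by positivity) J)
    congr 1
    ext z
    ring)
  convert key' using 3
  rw [← integral_const_mul]
  congr 1
  ext z
  rw [div_eq_mul_inv, mul_inv]
  ring

lemma norm_div_le_decayWeight (hc : 0 < c) (hIJ : Separated c p I J) (hKJ : Separated c p' K J)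
    {m : ℝ → ℂ} (hM : ∀ z, ‖m z‖ ≤ M) {x y z : ℝ} (hx : x ∈ I) (hy : y ∈ K) (hz : z ∈ J) :
    ‖m z / (((z : ℂ) - x) * ((z : ℂ) - y))‖ ≤ M * (1 + c⁻¹) ^ 2 *
      (decayWeight 1 p z * decayWeight (1 / 4) p' z) * decayWeight (3 / 4) p' y := by
  have hM0 : 0 ≤ M := (norm_nonneg _).trans (hM 0)
  have h1 := hIJ.norm_inv_le hc hx hz (q := 1) (r := 0) (by norm_num) (by norm_num) (by norm_num)
  have h2 := hKJ.norm_inv_le hc hy hz (q := 1 / 4) (r := 3 / 4) (by norm_num) (by norm_num)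
    (by norm_num)
  have h3 : decayWeight 0 p x = 1 := by simp [decayWeight]
  rw [h3, mul_one] at h1
  rw [div_eq_mul_inv, mul_inv, norm_mul, norm_mul]
  have w1 := decayWeight_nonneg 1 p z
  have w2 := decayWeight_nonneg (1 / 4) p' z
  have w3 := decayWeight_nonneg (3 / 4) p' y
  calc _ ≤ M * (((1 + c⁻¹) * decayWeight 1 p z) *
        ((1 + c⁻¹) * (decayWeight (1 / 4) p' z * decayWeight (3 / 4) p' y))) := by
        gcongr
        exact hM z
    _ = _ := by ring

lemma integrableOn_div (hc : 0 < c) (hJ : J.OrdConnected) (hIJ : Separated c p I J)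
    (hKJ : Separated c p' K J) {m : ℝ → ℂ} (hm : Measurable m) (hM : ∀ z, ‖m z‖ ≤ M) {x y : ℝ}
    (hx : x ∈ I) (hy : y ∈ K) :
    IntegrableOn (fun z : ℝ => m z / (((z : ℂ) - x) * ((z : ℂ) - y))) J := by
  refine Integrable.mono' (((integrable_decayWeight_mul p p').const_mul
    (M * (1 + c⁻¹) ^ 2)).mul_const (decayWeight (3 / 4) p' y)).integrableOn ?_
    (ae_restrict_of_forall_mem hJ.measurableSet fun z hz =>
      norm_div_le_decayWeight hc hIJ hKJ hM hx hy hz)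
  exact Measurable.aestronglyMeasurable (by fun_prop)

lemma integrable_kernel_mul (hc : 0 < c) (hJ : J.OrdConnected) (hK : K.OrdConnected)
    (hIJ : Separated c p I J)
    (hKJ : Separated c p' K J) {m : ℝ → ℂ} (hm : Measurable m) (hM : ∀ z, ‖m z‖ ≤ M) (x : ℝ)
    (e : L2R) :
    Integrable (fun y => Set.indicator I (fun _ => (1 : ℂ)) x *
      Set.indicator K (fun _ => (1 : ℂ)) y *
        (∫ z in J, m z / (((z : ℂ) - x) * ((z : ℂ) - y))) * e y) := by
  by_cases hx : x ∈ I
  swap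
  · simp [hx]
  have hM0 : 0 ≤ M := (norm_nonneg _).trans (hM 0)
  have mK : Measurable (Set.indicator K (fun _ => (1 : ℂ))) :=
    measurable_const.indicator hK.measurableSet
  have me : Measurable (e : ℝ → ℂ) := (Lp.stronglyMeasurable e).measurable
  have hdom : Integrable (fun q : ℝ × ℝ => (M * (1 + c⁻¹) ^ 2 *
      (decayWeight 1 p q.1 * decayWeight (1 / 4) p' q.1)) * (decayWeight (3 / 4) p' q.2 * ‖e q.2‖))
      ((volume.restrict J).prod volume) :=
    ((integrable_decayWeight_mul p p').const_mul _).integrableOn.mul_prod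
      ((memLp_decayWeight p').integrable_mul (Lp.memLp e).norm)
  have hint : Integrable (fun q : ℝ × ℝ => Set.indicator K (fun _ => (1 : ℂ)) q.2 *
      (m q.1 / (((q.1 : ℂ) - x) * ((q.1 : ℂ) - q.2)) * e q.2))
      ((volume.restrict J).prod volume) := by
    refine hdom.mono' (Measurable.aestronglyMeasurable (by fun_prop)) ?_
    filter_upwards [Measure.quasiMeasurePreserving_fst.ae (ae_restrict_mem hJ.measurableSet)]
      with q hq
    have w1 := decayWeight_nonneg 1 p q.1
    have w2 := decayWeight_nonneg (1 / 4) p' q.1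
    have w3 := decayWeight_nonneg (3 / 4) p' q.2
    refine norm_indicator_one_mul_le (by positivity) fun hy => ?_
    rw [norm_mul]
    exact (mul_le_mul_of_nonneg_right (norm_div_le_decayWeight hc hIJ hKJ hM hx hy hq)
      (norm_nonneg _)).trans (le_of_eq (by ring))
  refine hint.integral_prod_right.congr (Eventually.of_forall fun y => ?_)
  simp only [hx, Set.indicator_of_mem, one_mul]
  rw [integral_const_mul, integral_mul_const, mul_assoc]

/-- Integration by parts turns the kernel with density `g = G'` into boundary terms and terms with
better decay. -/
lemma nuclearKernel_of_hasDerivAt (hc : 0 < c) (hI : I.OrdConnected) (hJ : J.OrdConnected)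
    (hK : K.OrdConnected) (hI0 : I.Nonempty) (hJ0 : J.Nonempty) (hJc : IsClosed J)
    (hIJ : Separated c p I J) (hKJ : Separated c p' K J)
    {g : ℝ → ℂ} (hGg : ∀ z, HasDerivAt G (g z) z) (hM : ∀ z, ‖G z‖ ≤ M) {M' : ℝ}
    (hM' : ∀ z, ‖g z‖ ≤ M') :
    NuclearKernel (fun x y => Set.indicator I (fun _ => (1 : ℂ)) x *
        Set.indicator K (fun _ => (1 : ℂ)) y *
          ∫ z in J, g z / (((z : ℂ) - x) * ((z : ℂ) - y)))
      (2 * (M * (1 + c⁻¹) * (1 + c⁻¹) * (weightNorm * weightNorm)) +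
        2 * (M * (1 + c⁻¹) ^ 3 * (∫ z, decayWeight (5 / 4) 0 z) * (weightNorm * weightNorm))) := by
  have hGc : Continuous G := continuous_iff_continuousAt.mpr fun z => (hGg z).continuousAt
  have hgm : Measurable g := by
    have : g = deriv G := funext fun z => (hGg z).deriv.symm
    rw [this]
    exact measurable_deriv G
  have huniv : J ≠ Set.univ := by
    rintro rfl
    obtain ⟨x, hx⟩ := hI0
    have := hIJ.le_abs x hx x (Set.mem_univ x)
    simp at this
    linarith
  obtain ⟨a, ha, b, hb, α, β, hα, hβ, hbd⟩ :=
    exists_setIntegral_eq_boundary hJ hJc hJ0 huniv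
  have key := ((nuclearKernel_boundary hc hI hK hIJ hKJ hM hb hβ).add
    (nuclearKernel_boundary hc hI hK hIJ hKJ hM ha hα)).add
    ((nuclearKernel_left_sq hc hI hJ hK hIJ hKJ hGc.measurable hM).add
    (nuclearKernel_right_sq hc hI hJ hK hIJ hKJ hGc.measurable hM))
  convert key using 1
  swap
  · ring
  ext x y
  by_cases hx : x ∈ I
  swap
  · simp [hx]
  by_cases hy : y ∈ K
  swap
  · simp [hy]
  simp only [hx, hy, Set.indicator_of_mem, one_mul]
  have i0 := integrableOn_div hc hJ hIJ hKJ hgm hM' hx hy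
  have hinv : ∀ {S : Set ℝ} {q t : ℝ}, Separated c q S J → t ∈ S → ∀ z ∈ J,
      ‖((z : ℂ) - t)⁻¹‖ ≤ c⁻¹ := by
    intro S q t hS ht z hz
    rw [← Complex.ofReal_sub, norm_inv, Complex.norm_real, Real.norm_eq_abs]
    exact inv_anti₀ hc (hS.le_abs t ht z hz)
  have iG := integrableOn_div hc hJ hIJ hKJ hGc.measurable hM hx hy
  have i1 : IntegrableOn (fun z : ℝ => G z / (((z : ℂ) - x) ^ 2 * ((z : ℂ) - y))) J := by
    refine Integrable.mono' (iG.norm.const_mul c⁻¹)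
      (Measurable.aestronglyMeasurable (by have := hGc.measurable; fun_prop))
      (ae_restrict_of_forall_mem hJ.measurableSet fun z hz => ?_)
    rw [show G z / (((z : ℂ) - x) ^ 2 * ((z : ℂ) - y)) =
      ((z : ℂ) - x)⁻¹ * (G z / (((z : ℂ) - x) * ((z : ℂ) - y))) by
        simp only [div_eq_mul_inv, mul_inv, ← inv_pow]; ring, norm_mul]
    exact mul_le_mul_of_nonneg_right (hinv hIJ hx z hz) (norm_nonneg _)
  have i2 : IntegrableOn (fun z : ℝ => G z / (((z : ℂ) - x) * ((z : ℂ) - y) ^ 2)) J := by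
    refine Integrable.mono' (iG.norm.const_mul c⁻¹)
      (Measurable.aestronglyMeasurable (by have := hGc.measurable; fun_prop))
      (ae_restrict_of_forall_mem hJ.measurableSet fun z hz => ?_)
    rw [show G z / (((z : ℂ) - x) * ((z : ℂ) - y) ^ 2) =
      ((z : ℂ) - y)⁻¹ * (G z / (((z : ℂ) - x) * ((z : ℂ) - y))) by
        simp only [div_eq_mul_inv, mul_inv, ← inv_pow]; ring, norm_mul]
    exact mul_le_mul_of_nonneg_right (hinv hKJ hy z hz) (norm_nonneg _)
  have i12 : IntegrableOn (fun z : ℝ => G z / (((z : ℂ) - x) ^ 2 * ((z : ℂ) - y)) +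
      G z / (((z : ℂ) - x) * ((z : ℂ) - y) ^ 2)) J := i1.add i2
  have hparts := hbd (fun z => G z / (((z : ℂ) - x) * ((z : ℂ) - y)))
    (fun z => g z / (((z : ℂ) - x) * ((z : ℂ) - y)) -
      (G z / (((z : ℂ) - x) ^ 2 * ((z : ℂ) - y)) + G z / (((z : ℂ) - x) * ((z : ℂ) - y) ^ 2)))
    (fun z hz => by
      have nx := hIJ.sub_ne_zero hc hx hz
      have ny := hKJ.sub_ne_zero hc hy hz
      have dx : HasDerivAt (fun z : ℝ => (z : ℂ) - x) 1 z :=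
        (Complex.ofRealCLM.hasDerivAt (x := z)).sub_const _
      have dy : HasDerivAt (fun z : ℝ => (z : ℂ) - y) 1 z :=
        (Complex.ofRealCLM.hasDerivAt (x := z)).sub_const _
      refine ((hGg z).div (dx.mul dy) (mul_ne_zero nx ny)).congr_deriv ?_
      simp only [Pi.mul_apply]
      field_simp)
    (i0.sub i12) (by
      have h1 := (tendsto_inv_ofReal_sub_cocompact x).mul (tendsto_inv_ofReal_sub_cocompact y)
      rw [mul_zero] at h1
      have h2 := h1.norm.const_mul M
      rw [norm_zero, mul_zero] at h2
      refine squeeze_zero_norm (fun z => ?_) h2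
      rw [div_eq_mul_inv, mul_inv, norm_mul]
      exact mul_le_mul_of_nonneg_right (hM z) (norm_nonneg _))
  rw [integral_sub i0 i12, integral_add i1 i2] at hparts
  linear_combination hparts

end SeparatedKernels

lemma le_abs_sub_of_le_sDist {c : ℝ} {S T : Set ℝ} (h : c ≤ sDist S T) {x y : ℝ} (hx : x ∈ S)
    (hy : y ∈ T) : c ≤ |x - y| :=
  h.trans (csInf_le ⟨0, by rintro d ⟨x, -, y, -, rfl⟩; exact abs_nonneg _⟩ ⟨x, hx, y, hy, rfl⟩)

/-- replacing an almost-periodic function by its mean. For the continuous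
almost-periodic function `f(x) = Σ_{θ∈Θ} a_θ e^{iθx}` with
`Σ_{θ∈Θ, θ≠0} |a_θ|(1+|θ|⁻¹) < ∞`, and intervals `I, J, K` with `dist(I,J) ≥ c > 0`,
`dist(J,K) ≥ c > 0`, the operators `S_{I,J,K}(f)` and `S_{I,J,K}(ℳ(f))` (whose kernels are
`χ_I(x)χ_K(y)∫_J f(z)/((z-x)(z-y)) dz` resp. the same expression with `f` replaced by its
almost-periodic mean `ℳ(f) = a₀`) satisfy
`‖S_{I,J,K}(f) - S_{I,J,K}(ℳ(f))‖₁ ≤ C` with `C` independent of the intervals. -/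
theorem statement12
    (Θ : Set ℝ) (hΘ : Θ.Countable)
    (a : ℝ → ℂ) (hsupp : ∀ θ : ℝ, θ ∉ Θ → a θ = 0)
    (hsum : Summable fun θ : ↥(Θ \ {(0:ℝ)}) => ‖a θ‖ * (1 + |(θ : ℝ)|⁻¹))
    (f : ℝ → ℂ) (hf : ∀ x : ℝ, f x = ∑' θ : ↥Θ, a θ * Complex.exp (Complex.I * θ * x))
    (c : ℝ) (hc : 0 < c) :
    ∃ C : ℝ, ∀ I J K : Set ℝ,
      I.OrdConnected → J.OrdConnected → K.OrdConnected →
      I.Nonempty → J.Nonempty → K.Nonempty →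
      c ≤ sDist I J → c ≤ sDist J K →
      ∀ S1 S2 : L2R →L[ℂ] L2R,
        HasKernel S1 (fun x y =>
          Set.indicator I (fun _ => (1:ℂ)) x * Set.indicator K (fun _ => (1:ℂ)) y *
            ∫ z in J, f z / (((z : ℂ) - (x : ℂ)) * ((z : ℂ) - (y : ℂ)))) →
        HasKernel S2 (fun x y =>
          Set.indicator I (fun _ => (1:ℂ)) x * Set.indicator K (fun _ => (1:ℂ)) y *
            (a 0 * ∫ z in J, 1 / (((z : ℂ) - (x : ℂ)) * ((z : ℂ) - (y : ℂ))))) →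
        traceNorm (S1 - S2) ≤ ENNReal.ofReal C := by
  obtain ⟨G, M, hM0, hG, hGM, hfM⟩ := exists_bounded_antiderivative Θ a hsupp hsum f hf
  have hfm : Measurable f := by
    have : f = fun x => deriv G x + a 0 := funext fun x => by rw [(hG x).deriv]; ring
    rw [this]
    exact (measurable_deriv G).add_const _
  refine ⟨2 * (2 * (M * (1 + c⁻¹) * (1 + c⁻¹) * (weightNorm * weightNorm)) +
    2 * (M * (1 + c⁻¹) ^ 3 * (∫ z, decayWeight (5 / 4) 0 z) * (weightNorm * weightNorm))), ?_⟩
  intro I J K hI hJ hK hI0 hJ0 hK0 hIJ hJK S1 S2 hS1 hS2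
  have hcl : (closure J : Set ℝ) =ᵐ[volume] J := by
    refine closure_ae_eq_of_null_frontier ?_
    exact Convex.addHaar_frontier volume hJ.convex
  have hJ' : (closure J).OrdConnected := hJ.convex.closure.ordConnected
  have hJr : volume.restrict J = volume.restrict (closure J) :=
    (Measure.restrict_congr_set hcl).symm
  rw [hJr] at hS1 hS2
  obtain ⟨p, hp⟩ := exists_separated hc hI hJ hI0 hJ0 fun x hx z hz => by
    rw [abs_sub_comm]
    exact le_abs_sub_of_le_sDist hIJ hx hz
  obtain ⟨p', hp'⟩ := exists_separated hc hK hJ hK0 hJ0 fun y hy z hz =>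
    le_abs_sub_of_le_sDist hJK hz hy
  have hIJ' := hp.closure_right
  have hKJ' := hp'.closure_right
  have hnuc := nuclearKernel_of_hasDerivAt hc hI hJ' hK hI0 hJ0.closure isClosed_closure hIJ' hKJ'
    hG hGM (M' := M + ‖a 0‖) fun z => (norm_sub_le _ _).trans (add_le_add (hfM z) le_rfl)
  refine hnuc.traceNorm_le (S1 - S2) fun e => ?_
  filter_upwards [hS1 e, hS2 e, Lp.coeFn_sub (S1 e) (S2 e)] with x h1 h2 h3
  rw [sub_apply, h3, Pi.sub_apply, h1, h2]
  have hconst : ∀ y : ℝ, (a 0 * ∫ z in closure J, 1 / (((z : ℂ) - x) * ((z : ℂ) - y))) =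
      ∫ z in closure J, a 0 / (((z : ℂ) - x) * ((z : ℂ) - y)) := by
    intro y
    rw [← integral_const_mul]
    simp only [mul_one_div]
  simp only [hconst]
  rw [← integral_sub (integrable_kernel_mul hc hJ' hK hIJ' hKJ' hfm hfM x e)
    (integrable_kernel_mul hc hJ' hK hIJ' hKJ' (measurable_const (a := a 0))
      (fun _ => le_rfl) x e)]
  congr 1
  ext y
  by_cases hx : x ∈ I
  swap
  · simp [hx]
  by_cases hy : y ∈ K
  swap
  · simp [hy]
  simp only [sub_div]
  rw [integral_sub (integrableOn_div hc hJ' hIJ' hKJ' hfm hfM hx hy)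
    (integrableOn_div hc hJ' hIJ' hKJ' (measurable_const (a := a 0)) (fun _ => le_rfl) hx hy)]
  ring

end
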